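/- arXiv:dg-ga/9711003 — 3 statements merged into one kernel-verified Lean document; each statement's English description precedes it below -/
import Mathlib

section
/- Let $S$ be a unique factorization domain and let $\chi_1,\dots,\chi_n$ be prime elements of $S$ that are pairwise non-associated; set $c=\chi_1\cdots\chi_n$. Let $M$ be a free $S$-module and $N$ a torsion-free $S$-module, and let $i\colon M\to N$ be an $S$-linear map such that the induced map $M[1/c]\to N[1/c]$ between the localizations away from $c$ is bijective. For each $j\in\{1,\dots,n\}$ let $A_j\subseteq N$ be an $S$-submodule containing $i(M)$ with the property that for every $v\in A_j$ there exists $P\in S$ with $\chi_j\nmid P$ and $P\cdot v\in i(M)$. Then $i$ is injective and $i(M)=A_1\cap\cdots\cap A_n$. -/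
/-- A vector of a free module whose multiple by some `P` not divisible by the prime `p` is
divisible by `p` is itself divisible by `p`. -/
theorem exists_eq_smul_of_smul_eq_smul {S M : Type*} [CommRing S] [AddCommGroup M] [Module S M]
    [Module.Free S M] {p P : S} (hp : Prime p) (hP : ¬ p ∣ P) {x y : M} (h : P • x = p • y) :
    ∃ z, x = p • z := by
  have b := Module.Free.chooseBasis S M
  have hdvd : ∀ a, p ∣ b.repr x a := fun a ↦ by
    have ha : P * b.repr x a = p * b.repr y a := by
      simpa using DFunLike.congr_fun (congrArg b.repr h) a
    exact (hp.dvd_or_dvd (Dvd.intro _ ha.symm)).resolve_left hP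
  choose q hq using hdvd
  refine ⟨∑ a ∈ (b.repr x).support, q a • b a, ?_⟩
  conv_lhs => rw [← b.linearCombination_repr x, Finsupp.linearCombination_apply, Finsupp.sum]
  rw [Finset.smul_sum]
  exact Finset.sum_congr rfl fun a _ ↦ by rw [smul_smul, ← hq]

/-- If `i` is an injective map from a free module to a torsion-free module, then `w` lies in its
range as soon as `p • w` and `P • w` do, for a prime `p` not dividing `P`. -/
theorem LinearMap.mem_range_of_prime_smul_mem {S M N : Type*} [CommRing S] [IsDomain S]
    [AddCommGroup M] [Module S M] [AddCommGroup N] [Module S N]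
    [Module.Free S M] [NoZeroSMulDivisors S N] {i : M →ₗ[S] N} (hi : Function.Injective i)
    {p P : S} (hp : Prime p) (hP : ¬ p ∣ P) {w : N}
    (hpw : p • w ∈ LinearMap.range i) (hPw : P • w ∈ LinearMap.range i) :
    w ∈ LinearMap.range i := by
  obtain ⟨m, hm⟩ := hpw
  obtain ⟨m', hm'⟩ := hPw
  have h : P • m = p • m' := hi <| by rw [map_smul, map_smul, hm, hm', smul_comm]
  obtain ⟨z, rfl⟩ := exists_eq_smul_of_smul_eq_smul hp hP h
  exact ⟨z, smul_right_injective N hp.ne_zero (by simpa using hm)⟩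

/-- If the localization of `i` at `T` is surjective, then every vector of the target has a
multiple by an element of `T` in the range of `i`. -/
theorem LinearMap.exists_smul_mem_range_of_surjective_localizedModule_map {S M N : Type*}
    [CommRing S] [AddCommGroup M] [Module S M] [AddCommGroup N] [Module S N]
    {T : Submonoid S} {i : M →ₗ[S] N}
    (h : Function.Surjective (LocalizedModule.map T i)) (v : N) :
    ∃ s ∈ T, s • v ∈ LinearMap.range i := by
  obtain ⟨x, hx⟩ := h (LocalizedModule.mk v 1)
  induction x using LocalizedModule.induction_on with
  | h m s =>
    rw [LocalizedModule.map_mk, LocalizedModule.mk_eq] at hx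
    obtain ⟨u, hu⟩ := hx
    refine ⟨u * s, mul_mem u.2 s.2, (u : S) • m, ?_⟩
    simpa [Submonoid.smul_def, mul_smul] using hu

/-- If the localization of `i` at `T` is injective and `T` acts injectively on the source, then
`i` is injective. -/
theorem LinearMap.injective_of_injective_localizedModule_map {S M N : Type*}
    [CommRing S] [AddCommGroup M] [Module S M] [AddCommGroup N] [Module S N]
    {T : Submonoid S} (hT : ∀ s ∈ T, ∀ m : M, s • m = 0 → m = 0) {i : M →ₗ[S] N}
    (h : Function.Injective (LocalizedModule.map T i)) : Function.Injective i := by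
  refine (injective_iff_map_eq_zero i).2 fun m hm ↦ ?_
  have h0 : LocalizedModule.mk m (1 : T) = LocalizedModule.mk 0 1 :=
    h (by rw [LocalizedModule.map_mk, LocalizedModule.map_mk, hm, map_zero])
  obtain ⟨u, hu⟩ := LocalizedModule.mk_eq.1 h0
  exact hT u u.2 m (by simpa [Submonoid.smul_def] using hu)


/-- The algebraic skeleton of the localization theorem of Chang and Skjelbred:
if `i : M → N` is an `S`-linear map from a free module to a torsion-free module over
a UFD `S`, which becomes bijective after inverting `c = χ₁ ⋯ χₙ` (a product of pairwise
non-associated primes), and `A j` are submodules between `i(M)` and `N` such that every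
element of `A j` is moved into `i(M)` by some `P` not divisible by `χ j`, then `i` is
injective and `i(M) = A₁ ∩ ⋯ ∩ Aₙ`. -/
theorem localization_theorem_skeleton
    {S : Type*} [CommRing S] [IsDomain S] [UniqueFactorizationMonoid S]
    {M N : Type*} [AddCommGroup M] [Module S M] [AddCommGroup N] [Module S N]
    [Module.Free S M] [NoZeroSMulDivisors S N]
    {n : ℕ} (χ : Fin n → S) (hprime : ∀ j, Prime (χ j))
    (hassoc : ∀ j k, j ≠ k → ¬ Associated (χ j) (χ k))
    (i : M →ₗ[S] N)
    (hloc : Function.Bijective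
      (LocalizedModule.map (Submonoid.powers (∏ j, χ j)) i))
    (A : Fin n → Submodule S N)
    (hle : ∀ j, LinearMap.range i ≤ A j)
    (hA : ∀ j, ∀ v ∈ A j, ∃ P : S, ¬ χ j ∣ P ∧ P • v ∈ LinearMap.range i) :
    Function.Injective i ∧ LinearMap.range i = ⨅ j, A j := by
  have hc : ∏ j, χ j ≠ 0 := Finset.prod_ne_zero_iff.2 fun j _ ↦ (hprime j).ne_zero
  have hi : Function.Injective i := by
    refine LinearMap.injective_of_injective_localizedModule_map ?_ hloc.1
    rintro _ ⟨k, rfl⟩ m hm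
    exact (smul_eq_zero.1 hm).resolve_left (pow_ne_zero k hc)
  refine ⟨hi, le_antisymm (le_iInf hle) fun v hv ↦ ?_⟩
  let D : Submonoid S :=
    { carrier := {d | ∀ w ∈ ⨅ j, A j, d • w ∈ LinearMap.range i → w ∈ LinearMap.range i}
      one_mem' := fun w _ h ↦ by simpa using h
      mul_mem' := fun {a b} ha hb w hw h ↦
        hb w hw (ha (b • w) (Submodule.smul_mem _ b hw) (by rwa [smul_smul])) }
  have hχ : ∀ j, χ j ∈ D := fun j w hw h ↦ by
    obtain ⟨P, hP, hPw⟩ := hA j w ((Submodule.mem_iInf A).1 hw j)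
    exact LinearMap.mem_range_of_prime_smul_mem hi (hprime j) hP h hPw
  obtain ⟨_, ⟨k, rfl⟩, hk⟩ :=
    LinearMap.exists_smul_mem_range_of_surjective_localizedModule_map hloc.2 v
  exact pow_mem (prod_mem fun j _ ↦ hχ j) k v hv hk
end

section
/- Let $S$ be a commutative ring, $\chi\in S$, and $s\colon S\to S$ a ring homomorphism with $s\circ s=\mathrm{id}$, $s(\chi)=-\chi$, and such that $\chi$ divides $f-s(f)$ for every $f\in S$. Consider the subring $A$ of $S^4$ consisting of all quadruples $(f_1,f_2,f_3,f_4)$ such that $\chi$ divides each of $f_1-f_2$, $f_2-f_3$, $f_3-f_4$, and $\chi^2$ divides $(f_1+f_2)-(f_3+f_4)$, and the involution $\sigma$ of $A$ given by $\sigma(f_1,f_2,f_3,f_4)=(s(f_2),s(f_1),s(f_4),s(f_3))$. Then the fixed subring $A^{\sigma}$ equals $\{(f,s(f),g,s(g)) : f,g\in S,\ \chi \text{ divides } f-g\}$. -/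
/-- Fixed points of the involution `(f₁, f₂, f₃, f₄) ↦ (s f₂, s f₁, s f₄, s f₃)` on the
subring of `S⁴` cut out by `f₁ ≡ f₂ ≡ f₃ ≡ f₄ (mod χ)` and
`f₁ + f₂ ≡ f₃ + f₄ (mod χ²)`, where `s` is an involution with `s χ = -χ` and
`χ ∣ f - s f` for all `f`: they are exactly the quadruples `(f, s f, g, s g)` with
`χ ∣ f - g`. -/
theorem fixed_subring_ruled_surface
    {S : Type*} [CommRing S] (χ : S) (s : S →+* S)
    (hs : ∀ f, s (s f) = f) (hχ : s χ = -χ) (hdiv : ∀ f, χ ∣ f - s f) :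
    {p : S × S × S × S |
        (χ ∣ p.1 - p.2.1 ∧ χ ∣ p.2.1 - p.2.2.1 ∧ χ ∣ p.2.2.1 - p.2.2.2 ∧
          χ ^ 2 ∣ (p.1 + p.2.1) - (p.2.2.1 + p.2.2.2)) ∧
        (s p.2.1, s p.1, s p.2.2.2, s p.2.2.1) = p}
      = {p : S × S × S × S | ∃ f g : S, χ ∣ f - g ∧ p = (f, s f, g, s g)} := by
  ext ⟨a, b, c, d⟩
  simp only [Set.mem_ofPred_eq, Prod.mk.injEq]
  constructor
  · rintro ⟨⟨hab, hbc, -, -⟩, -, hb, -, hd⟩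
    exact ⟨a, c, by simpa using dvd_add hab hbc, rfl, hb.symm, rfl, hd.symm⟩
  · rintro ⟨f, g, hfg, rfl, rfl, rfl, rfl⟩
    refine ⟨⟨hdiv _, ?_, hdiv _, ?_⟩, hs _, rfl, hs _, rfl⟩
    · simpa using dvd_sub hfg (hdiv a)
    · obtain ⟨h, hh⟩ := hfg
      obtain ⟨k, hk⟩ := hdiv h
      have hsh : s a - s c = -χ * s h := by rw [← map_sub, hh, map_mul, hχ]
      exact ⟨k, by linear_combination hh + hsh + χ * hk⟩
end

section
/- Let $S$ be a commutative ring, $\chi\in S$, and $s\colon S\to S$ a ring homomorphism with $s\circ s=\mathrm{id}$, $s(\chi)=-\chi$, and such that $\chi$ divides $f-s(f)$ for every $f\in S$. Consider the subring $A$ of $S^3$ consisting of all triples $(f_1,f_2,f_3)$ such that $\chi$ divides $f_1-f_2$ and $f_2-f_3$, and $\chi^2$ divides $(f_1+f_2)-2f_3$, and the involution $\sigma$ of $A$ given by $\sigma(f_1,f_2,f_3)=(s(f_2),s(f_1),s(f_3))$. Then the fixed subring $A^{\sigma}$ equals $\{(f,s(f),g) : f,g\in S,\ s(g)=g,\ \chi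 \text{ divides } f-g\}$. -/
/-- Fixed points of the involution `(f₁, f₂, f₃) ↦ (s f₂, s f₁, s f₃)` on the subring of
`S³` cut out by `f₁ ≡ f₂ ≡ f₃ (mod χ)` and `f₁ + f₂ ≡ 2 f₃ (mod χ²)`, where `s` is an
involution with `s χ = -χ` and `χ ∣ f - s f` for all `f`: they are exactly the triples
`(f, s f, g)` with `s g = g` and `χ ∣ f - g`. -/
theorem fixed_subring_projectivization
    {S : Type*} [CommRing S] (χ : S) (s : S →+* S)
    (hs : ∀ f, s (s f) = f) (hχ : s χ = -χ) (hdiv : ∀ f, χ ∣ f - s f) :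
    {p : S × S × S |
        (χ ∣ p.1 - p.2.1 ∧ χ ∣ p.2.1 - p.2.2 ∧
          χ ^ 2 ∣ (p.1 + p.2.1) - 2 * p.2.2) ∧
        (s p.2.1, s p.1, s p.2.2) = p}
      = {p : S × S × S | ∃ f g : S, s g = g ∧ χ ∣ f - g ∧ p = (f, s f, g)} := by
  ext ⟨a, b, c⟩
  simp only [Set.mem_ofPred_eq, Prod.mk.injEq]
  constructor
  · rintro ⟨⟨hab, hbc, -⟩, -, hb, hc⟩
    refine ⟨a, c, hc, ?_, rfl, hb.symm, rfl⟩
    simpa using dvd_add hab hbc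
  · rintro ⟨f, g, hg, ⟨h, hh⟩, rfl, rfl, rfl⟩
    have hsh : s a - c = -χ * s h := by
      rw [← hχ, ← map_mul, ← hh, map_sub, hg]
    obtain ⟨k, hk⟩ := hdiv h
    refine ⟨⟨hdiv a, ⟨-s h, ?_⟩, ⟨k, ?_⟩⟩, hs a, rfl, hg⟩
    · rw [hsh]
      ring
    · linear_combination hh + hsh + χ * hk
end
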